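/- Let λ_3 be the greatest real root of the polynomial X³ − 2X² − 4X + 2 (one has λ_3 = 3.08613…). Then S_F^{(3)}(N) ≍ N^{(log λ_3)/(log φ)} as N → ∞. -/

import Mathlib

/-- The Fibonacci sequence with `f 1 = 1`, `f 2 = 2`, `f (n+2) = f (n+1) + f n`
(the value at `0` is a dummy). -/
def fibS : ℕ → ℕ
  | 0 => 0
  | 1 => 1
  | 2 => 2
  | n + 3 => fibS (n + 2) + fibS (n + 1)

/-- `rF n` is the number of ways to write `n` as a sum of distinct Fibonacci numbers,
i.e. the number of finite sets `S` of positive integers with `∑ i ∈ S, fibS i = n`. -/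
noncomputable def rF (n : ℕ) : ℕ :=
  Nat.card {S : Finset ℕ // 0 ∉ S ∧ ∑ i ∈ S, fibS i = n}

/-- The power sum `S_F^{(p)}(N) = ∑_{n=0}^{N-1} (rF n)^p`. -/
noncomputable def SF (p N : ℕ) : ℕ :=
  ∑ n ∈ Finset.range N, (rF n) ^ p

/-- The golden ratio. -/
noncomputable def phi : ℝ := (1 + Real.sqrt 5) / 2

open scoped ENNReal

/-- The number of subsets of `{1, …, m}` whose Fibonacci sum is the integer `n`. -/
noncomputable def fibCount (m : ℕ) (n : ℤ) : ℝ≥0∞ :=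
  ∑ S ∈ (Finset.Icc 1 m).powerset, if ((∑ i ∈ S, fibS i : ℕ) : ℤ) = n then 1 else 0

/-- The total cube of `fibCount m`. -/
noncomputable def cubeSum (m : ℕ) : ℝ≥0∞ := ∑' n : ℤ, fibCount m n ^ 3

/-- The correlation of `fibCount m ^ 2` with the shift of `fibCount m` by the next Fibonacci
number. -/
noncomputable def shiftSum (m : ℕ) : ℝ≥0∞ :=
  ∑' n : ℤ, fibCount m n ^ 2 * fibCount m (n - Nat.fib (m + 2))

/-- The integer recursion satisfied by `cubeSum m`, `shiftSum m`, `shiftSum (m + 1)`. -/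
def cubeRec : ℕ → ℕ × ℕ × ℕ
  | 0 => (1, 0, 0)
  | m + 1 =>
    let v := cubeRec m
    (2 * v.1 + 6 * v.2.1, v.2.2, v.1 + 4 * v.2.1)

theorem fibS_succ (n : ℕ) : fibS (n + 1) = Nat.fib (n + 2) := by
  induction n using Nat.strong_induction_on with
  | _ n ih =>
    match n with
    | 0 => rfl
    | 1 => rfl
    | k + 2 =>
      have h1 := ih (k + 1) (by omega)
      have h2 := ih k (by omega)
      have h3 := Nat.fib_add_two (n := k + 2)
      have h4 : fibS (k + 2 + 1) = fibS (k + 2) + fibS (k + 1) := rfl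
      rw [h4, h1, h2]
      lia

theorem fibCount_zero (n : ℤ) : fibCount 0 n = if n = 0 then 1 else 0 := by
  rw [fibCount, Finset.Icc_eq_empty (by omega), Finset.powerset_empty, Finset.sum_singleton]
  simp [eq_comm]

theorem fibCount_succ (m : ℕ) (n : ℤ) :
    fibCount (m + 1) n = fibCount m n + fibCount m (n - Nat.fib (m + 2)) := by
  have hm : m + 1 ∉ Finset.Icc 1 m := by simp
  have hI : Finset.Icc 1 (m + 1) = insert (m + 1) (Finset.Icc 1 m) := by
    ext i; simp only [Finset.mem_Icc, Finset.mem_insert]; omega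
  unfold fibCount
  rw [hI, Finset.sum_powerset_insert hm]
  congr 1
  refine Finset.sum_congr rfl fun S hS => ?_
  have hS' : m + 1 ∉ S := fun h => hm (Finset.mem_powerset.1 hS h)
  rw [Finset.sum_insert hS', fibS_succ]
  push_cast
  congr 1
  apply propext
  constructor <;> intro h <;> linarith

theorem fibCount_of_neg (m : ℕ) {n : ℤ} (hn : n < 0) : fibCount m n = 0 := by
  induction m generalizing n with
  | zero => rw [fibCount_zero, if_neg hn.ne]
  | succ m ih => rw [fibCount_succ, ih hn, ih (by omega), add_zero]

theorem fibCount_of_large (m : ℕ) {n : ℤ} (hn : Nat.fib (m + 3) < n + 2) :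
    fibCount m n = 0 := by
  induction m generalizing n with
  | zero =>
    have h3 : Nat.fib 3 = 2 := rfl
    rw [fibCount_zero, if_neg]
    simp only [zero_add, h3] at hn
    push_cast at hn
    omega
  | succ m ih =>
    have h := Nat.fib_add_two (n := m + 2)
    have hn' : (Nat.fib (m + 2 + 2) : ℤ) < n + 2 := hn
    rw [h] at hn'
    push_cast at hn'
    rw [fibCount_succ, ih (by lia), ih (by lia), add_zero]

theorem fibCount_symm (m : ℕ) (n : ℤ) :
    fibCount m (Nat.fib (m + 3) - 2 - n) = fibCount m n := by
  induction m generalizing n with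
  | zero =>
    have h3 : Nat.fib 3 = 2 := rfl
    simp [fibCount_zero, h3]
  | succ m ih =>
    have h : (Nat.fib (m + 1 + 3) : ℤ) = Nat.fib (m + 2) + Nat.fib (m + 3) := by
      exact_mod_cast Nat.fib_add_two (n := m + 2)
    rw [fibCount_succ, fibCount_succ, add_comm, ← ih n, ← ih (n - Nat.fib (m + 2)), h]
    congr 2 <;> ring

theorem shiftSum_eq (m : ℕ) :
    ∑' n : ℤ, fibCount m n * fibCount m (n - Nat.fib (m + 2)) ^ 2 = shiftSum m := by
  unfold shiftSum
  rw [← (Equiv.subLeft ((Nat.fib (m + 3) : ℤ) - 2 + Nat.fib (m + 2))).tsum_eq]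
  refine tsum_congr fun n => ?_
  simp only [Equiv.subLeft_apply]
  rw [← fibCount_symm m n, ← fibCount_symm m (n - _)]
  rw [mul_comm]
  ring_nf

theorem cubeSum_succ (m : ℕ) : cubeSum (m + 1) = 2 * cubeSum m + 6 * shiftSum m := by
  have hs : ∑' n : ℤ, fibCount m (n - Nat.fib (m + 2)) ^ 3 = cubeSum m :=
    (Equiv.subRight (Nat.fib (m + 2) : ℤ)).tsum_eq fun n => fibCount m n ^ 3
  have h : ∀ n : ℤ, fibCount (m + 1) n ^ 3 =
      fibCount m n ^ 3 + 3 * (fibCount m n ^ 2 * fibCount m (n - Nat.fib (m + 2))) +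
      3 * (fibCount m n * fibCount m (n - Nat.fib (m + 2)) ^ 2) +
      fibCount m (n - Nat.fib (m + 2)) ^ 3 := fun n => by
    rw [fibCount_succ]; ring
  rw [cubeSum, tsum_congr h, ENNReal.tsum_add, ENNReal.tsum_add, ENNReal.tsum_add,
    ENNReal.tsum_mul_left, ENNReal.tsum_mul_left, shiftSum_eq, hs, ← shiftSum, ← cubeSum]
  ring

theorem tsum_fibCount_succ_sq_mul (m : ℕ) :
    ∑' n : ℤ, fibCount (m + 1) n ^ 2 * fibCount (m + 1) (n - Nat.fib (m + 2)) =
      cubeSum m + 4 * shiftSum m := by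
  have hs : ∑' n : ℤ, fibCount m (n - Nat.fib (m + 2)) ^ 3 = cubeSum m :=
    (Equiv.subRight (Nat.fib (m + 2) : ℤ)).tsum_eq fun n => fibCount m n ^ 3
  have hu : ∑' n : ℤ, fibCount m (n - Nat.fib (m + 2)) ^ 2 *
      fibCount m (n - Nat.fib (m + 2) - Nat.fib (m + 2)) = shiftSum m :=
    (Equiv.subRight (Nat.fib (m + 2) : ℤ)).tsum_eq fun n =>
      fibCount m n ^ 2 * fibCount m (n - Nat.fib (m + 2))
  have h : ∀ n : ℤ, fibCount (m + 1) n ^ 2 * fibCount (m + 1) (n - Nat.fib (m + 2)) =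
      fibCount m n ^ 2 * fibCount m (n - Nat.fib (m + 2)) +
      2 * (fibCount m n * fibCount m (n - Nat.fib (m + 2)) ^ 2) +
      fibCount m (n - Nat.fib (m + 2)) ^ 3 +
      fibCount m (n - Nat.fib (m + 2)) ^ 2 *
        fibCount m (n - Nat.fib (m + 2) - Nat.fib (m + 2)) := fun n => by
    have h0 : fibCount m n * fibCount m (n - Nat.fib (m + 2) - Nat.fib (m + 2)) = 0 := by
      have hf := Nat.fib_add_two (n := m + 1)
      have hle := Nat.fib_le_fib_succ (n := m + 1)
      rcases lt_or_ge (n - Nat.fib (m + 2) - Nat.fib (m + 2) : ℤ) 0 with hn | hn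
      · rw [fibCount_of_neg m hn, mul_zero]
      · rw [fibCount_of_large m (n := n) (by lia), zero_mul]
    rw [fibCount_succ, fibCount_succ]
    generalize fibCount m n = a, fibCount m (n - Nat.fib (m + 2)) = b,
      fibCount m (n - Nat.fib (m + 2) - Nat.fib (m + 2)) = c at h0 ⊢
    calc (a + b) ^ 2 * (b + c) =
          a ^ 2 * b + 2 * (a * b ^ 2) + b ^ 3 + b ^ 2 * c + (a + 2 * b) * (a * c) := by ring
      _ = _ := by rw [h0, mul_zero, add_zero]
  rw [tsum_congr h, ENNReal.tsum_add, ENNReal.tsum_add, ENNReal.tsum_add,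
    ENNReal.tsum_mul_left, shiftSum_eq, hs, hu, ← shiftSum]
  ring

theorem shiftSum_add_two (m : ℕ) : shiftSum (m + 2) = cubeSum m + 4 * shiftSum m := by
  rw [← tsum_fibCount_succ_sq_mul, ← (Equiv.subRight (Nat.fib (m + 3) : ℤ)).tsum_eq, shiftSum]
  refine tsum_congr fun n => ?_
  simp only [Equiv.subRight_apply]
  have hf : (Nat.fib (m + 2 + 2) : ℤ) = Nat.fib (m + 2) + Nat.fib (m + 3) := by
    exact_mod_cast Nat.fib_add_two (n := m + 2)
  have hf' : (Nat.fib (m + 1 + 3) : ℤ) = Nat.fib (m + 2) + Nat.fib (m + 3) := hf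
  rw [hf]
  rcases lt_or_ge n (Nat.fib (m + 2) + Nat.fib (m + 3) : ℤ) with hn | hn
  · rw [fibCount_of_neg (m + 2) (n := n - _) (by lia),
      fibCount_of_neg (m + 1) (n := n - _ - _) (by lia), mul_zero, mul_zero]
  · have h1 : fibCount (m + 2) n = fibCount (m + 1) (n - Nat.fib (m + 3)) := by
      rw [fibCount_succ (m + 1), fibCount_of_large (m + 1) (n := n) (by lia), zero_add]
    rw [h1, fibCount_succ (m + 1) (n - _)]
    rcases lt_or_ge (n - Nat.fib (m + 3) : ℤ) (Nat.fib (m + 2) + Nat.fib (m + 3) : ℤ)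
      with hn' | hn'
    · rw [fibCount_of_neg (m + 1)
        (n := n - (Nat.fib (m + 2) + Nat.fib (m + 3)) - Nat.fib (m + 1 + 2))
        (by have : Nat.fib (m + 1 + 2) = Nat.fib (m + 3) := rfl
            lia), add_zero]
      congr 2
      ring
    · rw [fibCount_of_large (m + 1) (n := n - Nat.fib (m + 3)) (by lia)]
      simp

theorem cubeSum_zero : cubeSum 0 = 1 := by
  rw [cubeSum, tsum_eq_single 0]
  · simp [fibCount_zero]
  · intro n hn
    simp [fibCount_zero, hn]

theorem shiftSum_zero : shiftSum 0 = 0 := by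
  rw [shiftSum, ENNReal.tsum_eq_zero]
  intro n
  by_cases hn : n = 0
  · simp [fibCount_zero, hn]
  · simp [fibCount_zero, hn]

theorem shiftSum_one : shiftSum 1 = 0 := by
  have h3 : Nat.fib 3 = 2 := rfl
  rw [shiftSum, ENNReal.tsum_eq_zero]
  intro n
  rcases lt_or_ge n 2 with hn | hn
  · rw [fibCount_of_neg 1 (n := n - _) (by simp [h3]; omega), mul_zero]
  · have h4 : Nat.fib 4 = 3 := rfl
    rw [fibCount_of_large 1 (n := n) (by simp [h4]; omega)]
    simp

theorem cubeRec_spec (m : ℕ) :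
    cubeSum m = (cubeRec m).1 ∧ shiftSum m = (cubeRec m).2.1 ∧
      shiftSum (m + 1) = (cubeRec m).2.2 := by
  induction m with
  | zero => simp [cubeRec, cubeSum_zero, shiftSum_zero, shiftSum_one]
  | succ m ih =>
    obtain ⟨h1, h2, h3⟩ := ih
    refine ⟨?_, ?_, ?_⟩
    · rw [cubeSum_succ, h1, h2]; simp [cubeRec]
    · rw [h3]; simp [cubeRec]
    · rw [shiftSum_add_two, h1, h2]; simp [cubeRec]

theorem cubeRec_bounds (m : ℕ) :
    (cubeRec m).2.1 ≤ (cubeRec m).1 ∧ (cubeRec m).2.2 ≤ 2 * (cubeRec m).1 := by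
  induction m with
  | zero => simp [cubeRec]
  | succ m ih => simp only [cubeRec]; omega

theorem cubeRec_eigen {lam : ℝ} (hroot : lam ^ 3 - 2 * lam ^ 2 - 4 * lam + 2 = 0) (m : ℕ) :
    ((cubeRec m).1 : ℝ) + lam * (lam - 2) * (cubeRec m).2.1 + (lam - 2) * (cubeRec m).2.2 =
      lam ^ m := by
  induction m with
  | zero => simp [cubeRec]
  | succ m ih =>
    rw [pow_succ, ← ih]
    simp only [cubeRec]
    push_cast
    linear_combination (-((cubeRec m).2.1 : ℝ)) * hroot

theorem fibCount_mono {m M : ℕ} (h : m ≤ M) (n : ℤ) : fibCount m n ≤ fibCount M n := by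
  induction M, h using Nat.le_induction with
  | base => exact le_rfl
  | succ k _ ih => exact ih.trans (by rw [fibCount_succ]; exact le_self_add)

theorem rF_eq_fibCount {m n : ℕ} (h : n < Nat.fib (m + 2)) :
    (rF n : ℝ≥0∞) = fibCount m n := by
  have hcard : rF n =
      ((Finset.Icc 1 m).powerset.filter fun S => ∑ i ∈ S, fibS i = n).card := by
    rw [rF]
    refine Nat.subtype_card _ fun S => ?_
    simp only [Finset.mem_filter, Finset.mem_powerset]
    refine and_congr_left fun hS => ⟨fun hsub h0 => by simpa using hsub h0, fun h0 i hi => ?_⟩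
    have hi0 : i ≠ 0 := fun h => h0 (h ▸ hi)
    obtain ⟨j, rfl⟩ := Nat.exists_eq_succ_of_ne_zero hi0
    have hle : fibS (j + 1) ≤ n := hS ▸ Finset.single_le_sum (fun _ _ => Nat.zero_le _) hi
    rw [fibS_succ] at hle
    have hjm : j < m := by
      by_contra hmj
      have := Nat.fib_mono (show m + 2 ≤ j + 2 by omega)
      omega
    simp only [Finset.mem_Icc]
    omega
  rw [hcard, Finset.card_filter, fibCount]
  push_cast
  simp only [← Nat.cast_sum, Nat.cast_inj]

theorem fibCount_le_rF (m n : ℕ) : fibCount m n ≤ rF n := by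
  have h : n < Nat.fib (m + n + 1 + 2) := by
    have := Nat.le_fib_add_one (m + n + 3)
    lia
  rw [rF_eq_fibCount h]
  exact fibCount_mono (by omega) n

theorem SF_fib_le (m : ℕ) : SF 3 (Nat.fib (m + 2)) ≤ (cubeRec m).1 := by
  have h : (SF 3 (Nat.fib (m + 2)) : ℝ≥0∞) ≤ cubeSum m := by
    rw [SF]
    push_cast
    calc ∑ n ∈ Finset.range (Nat.fib (m + 2)), (rF n : ℝ≥0∞) ^ 3
        = ∑ n ∈ Finset.range (Nat.fib (m + 2)), fibCount m (n : ℕ) ^ 3 :=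
          Finset.sum_congr rfl fun n hn => by rw [rF_eq_fibCount (Finset.mem_range.1 hn)]
      _ ≤ ∑' n : ℕ, fibCount m n ^ 3 := ENNReal.sum_le_tsum _
      _ ≤ cubeSum m :=
          ENNReal.tsum_comp_le_tsum_of_injective Nat.cast_injective
            fun n : ℤ => fibCount m n ^ 3
  rw [(cubeRec_spec m).1] at h
  exact_mod_cast h

theorem le_SF_fib (m : ℕ) : (cubeRec m).1 ≤ SF 3 (Nat.fib (m + 3)) := by
  have h : cubeSum m ≤ (SF 3 (Nat.fib (m + 3)) : ℝ≥0∞) := by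
    rw [cubeSum, tsum_eq_sum (s := (Finset.range (Nat.fib (m + 3))).map Nat.castEmbedding),
      Finset.sum_map, SF]
    · push_cast
      exact Finset.sum_le_sum fun n _ => pow_le_pow_left' (fibCount_le_rF m n) 3
    · intro n hn
      have : fibCount m n = 0 := by
        rcases lt_or_ge n 0 with h0 | h0
        · exact fibCount_of_neg m h0
        · refine fibCount_of_large m ?_
          by_contra hlt
          refine hn (Finset.mem_map.2 ⟨n.toNat, Finset.mem_range.2 (by lia), ?_⟩)
          simp [h0]
      simp [this]
  rw [(cubeRec_spec m).1] at h
  exact_mod_cast h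

theorem SF_mono (p : ℕ) : Monotone (SF p) := fun _ _ h =>
  Finset.sum_le_sum_of_subset (Finset.range_mono h)

theorem phi_sq : phi ^ 2 = phi + 1 := Real.goldenRatio_sq

theorem one_lt_phi : 1 < phi := Real.one_lt_goldenRatio

theorem fib_phi_bounds (n : ℕ) :
    phi ^ n ≤ Nat.fib (n + 2) ∧ (Nat.fib (n + 1) : ℝ) ≤ phi ^ n := by
  have h1 := one_lt_phi
  have h2 := phi_sq
  induction n using Nat.strong_induction_on with
  | _ n ih =>
    match n with
    | 0 => simp
    | 1 =>
      have : Nat.fib 3 = 2 := rfl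
      simp only [pow_one, Nat.reduceAdd, this, Nat.fib_two]
      push_cast
      constructor <;> nlinarith
    | k + 2 =>
      obtain ⟨a1, a2⟩ := ih k (by omega)
      obtain ⟨b1, b2⟩ := ih (k + 1) (by omega)
      have hp : phi ^ (k + 2) = phi ^ k + phi ^ (k + 1) := by
        rw [pow_add, h2]; ring
      have c1 : (Nat.fib (k + 2 + 2) : ℝ) = Nat.fib (k + 2) + Nat.fib (k + 1 + 2) := by
        exact_mod_cast Nat.fib_add_two (n := k + 2)
      have c2 : (Nat.fib (k + 2 + 1) : ℝ) = Nat.fib (k + 1) + Nat.fib (k + 1 + 1) := by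
        exact_mod_cast Nat.fib_add_two (n := k + 1)
      exact ⟨by linarith, by linarith⟩

theorem exists_fib_le_lt {N : ℕ} (hN : 2 ≤ N) :
    ∃ m, Nat.fib (m + 3) ≤ N ∧ N < Nat.fib (m + 4) := by
  have hex : ∃ k, N < Nat.fib (k + 3) := ⟨N, by
    have := Nat.le_fib_add_one (N + 3)
    lia⟩
  classical
  have hpos : Nat.find hex ≠ 0 := fun h0 => by
    have := Nat.find_spec hex
    rw [h0] at this
    exact absurd this (not_lt.2 hN)
  obtain ⟨m, hm⟩ := Nat.exists_eq_succ_of_ne_zero hpos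
  refine ⟨m, ?_, ?_⟩
  · exact not_lt.1 (Nat.find_min hex (by omega))
  · have := Nat.find_spec hex
    rw [hm] at this
    exact this

theorem three_le_of_greatest_root {lam : ℝ}
    (hgreatest : ∀ x : ℝ, x ^ 3 - 2 * x ^ 2 - 4 * x + 2 = 0 → x ≤ lam) : 3 ≤ lam := by
  have hc : ContinuousOn (fun x : ℝ => x ^ 3 - 2 * x ^ 2 - 4 * x + 2) (Set.Icc 3 4) := by
    fun_prop
  obtain ⟨x, hx, hx0⟩ := intermediate_value_Icc (by norm_num) hc
    (show (0 : ℝ) ∈ Set.Icc _ _ by norm_num)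
  exact hx.1.trans (hgreatest x hx0)

theorem phi_pow_rpow {lam : ℝ} (hlam : 0 < lam) (k : ℕ) :
    (phi ^ k) ^ (Real.log lam / Real.log phi) = lam ^ k := by
  have h1 := one_lt_phi
  have h0 : 0 < phi := by linarith
  have h : phi ^ (Real.log lam / Real.log phi) = lam := by
    rw [Real.rpow_def_of_pos h0, mul_div_cancel₀ _ (Real.log_pos h1).ne', Real.exp_log hlam]
  rw [← Real.rpow_natCast, ← Real.rpow_mul h0.le, mul_comm, Real.rpow_mul h0.le, h,
    Real.rpow_natCast]

theorem SF_three_asymp (lam : ℝ)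
    (hroot : lam ^ 3 - 2 * lam ^ 2 - 4 * lam + 2 = 0)
    (hgreatest : ∀ x : ℝ, x ^ 3 - 2 * x ^ 2 - 4 * x + 2 = 0 → x ≤ lam) :
    ∃ c C : ℝ, 0 < c ∧ c ≤ C ∧ ∃ N₀ : ℕ, ∀ N : ℕ, N₀ ≤ N →
      c * (N : ℝ) ^ (Real.log lam / Real.log phi) ≤ (SF 3 N : ℝ) ∧
      (SF 3 N : ℝ) ≤ C * (N : ℝ) ^ (Real.log lam / Real.log phi) := by
  have h3 := three_le_of_greatest_root hgreatest
  have hlam : 0 < lam := by linarith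
  have hphi := one_lt_phi
  have hα : 0 ≤ Real.log lam / Real.log phi :=
    div_nonneg (Real.log_nonneg (by linarith)) (Real.log_pos hphi).le
  set D : ℝ := 1 + lam * (lam - 2) + 2 * (lam - 2) with hD
  have hD1 : 1 ≤ D := by nlinarith
  have hDl : 1 ≤ D * lam ^ 3 := one_le_mul_of_one_le_of_one_le hD1 (one_le_pow₀ (by linarith))
  refine ⟨(D * lam ^ 3)⁻¹, lam, by positivity, (inv_le_one_of_one_le₀ hDl).trans (by linarith),
    2, fun N hN => ?_⟩
  obtain ⟨m, hm1, hm2⟩ := exists_fib_le_lt hN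
  have hlow : phi ^ (m + 1) ≤ (N : ℝ) :=
    (fib_phi_bounds (m + 1)).1.trans (by exact_mod_cast hm1)
  have hupp : (N : ℝ) ≤ phi ^ (m + 3) :=
    le_trans (by exact_mod_cast hm2.le) (fib_phi_bounds (m + 3)).2
  have hplow : lam ^ (m + 1) ≤ (N : ℝ) ^ (Real.log lam / Real.log phi) := by
    rw [← phi_pow_rpow hlam]
    exact Real.rpow_le_rpow (by positivity) hlow hα
  have hpupp : (N : ℝ) ^ (Real.log lam / Real.log phi) ≤ lam ^ (m + 3) := by
    rw [← phi_pow_rpow hlam]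
    exact Real.rpow_le_rpow (by positivity) hupp hα
  constructor
  · have hS : ((cubeRec m).1 : ℝ) ≤ SF 3 N := by
      exact_mod_cast (le_SF_fib m).trans (SF_mono 3 hm1)
    have hb : ((cubeRec m).2.1 : ℝ) ≤ (cubeRec m).1 ∧
        ((cubeRec m).2.2 : ℝ) ≤ 2 * (cubeRec m).1 := by
      exact_mod_cast cubeRec_bounds m
    have hL : lam ^ m ≤ D * (cubeRec m).1 := by
      rw [← cubeRec_eigen hroot m]
      have h1 := mul_le_mul_of_nonneg_left hb.1 (show 0 ≤ lam * (lam - 2) by nlinarith)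
      have h2 := mul_le_mul_of_nonneg_left hb.2 (show 0 ≤ lam - 2 by linarith)
      linarith
    rw [inv_mul_le_iff₀ (by positivity)]
    calc (N : ℝ) ^ (Real.log lam / Real.log phi) ≤ lam ^ m * lam ^ 3 := by
          rw [← pow_add]; exact hpupp
      _ ≤ D * (cubeRec m).1 * lam ^ 3 := by gcongr
      _ ≤ D * SF 3 N * lam ^ 3 := by gcongr
      _ = D * lam ^ 3 * SF 3 N := by ring
  · have hS : (SF 3 N : ℝ) ≤ (cubeRec (m + 2)).1 := by
      exact_mod_cast (SF_mono 3 hm2.le).trans (SF_fib_le (m + 2))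
    have hL : ((cubeRec (m + 2)).1 : ℝ) ≤ lam ^ (m + 2) := by
      rw [← cubeRec_eigen hroot (m + 2)]
      have h1 : 0 ≤ lam * (lam - 2) * (cubeRec (m + 2)).2.1 :=
        mul_nonneg (by nlinarith) (Nat.cast_nonneg _)
      have h2 : 0 ≤ (lam - 2) * (cubeRec (m + 2)).2.2 :=
        mul_nonneg (by linarith) (Nat.cast_nonneg _)
      linarith
    calc (SF 3 N : ℝ) ≤ lam ^ (m + 2) := hS.trans hL
      _ = lam * lam ^ (m + 1) := by ring
      _ ≤ _ := by gcongr
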